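/- Let μ be a regular cardinal with μ > ℵ₁, and suppose there is a non-reflecting stationary subset E of E^μ_ω := {α < μ : cf(α) = ω}. Then there exists a stationary subset S of [μ]^{ℵ₀} such that for every X ⊆ μ with |X| < μ and ω₁ ⊆ X, the set S ∩ [X]^{ℵ₀} is a non-stationary subset of [X]^{ℵ₀}. -/

import Mathlib

/-- `C ⊆ δ` is club in `δ`: unbounded in `δ` and closed under suprema of
nonempty subsets whose supremum is `< δ`. -/
def IsClubIn (C : Set Ordinal) (δ : Ordinal) : Prop :=
  C ⊆ Set.Iio δ ∧ (∀ α < δ, ∃ β ∈ C, α ≤ β) ∧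
    ∀ B : Set Ordinal, B ⊆ C → B.Nonempty → sSup B < δ → sSup B ∈ C

/-- `S` is stationary in `δ`: it meets every club subset of `δ`. -/
def IsStationaryIn (S : Set Ordinal) (δ : Ordinal) : Prop :=
  ∀ C : Set Ordinal, IsClubIn C δ → (S ∩ C).Nonempty

/-- The ordinal `μ` is an infinite regular cardinal. -/
def IsInfRegular (μ : Ordinal) : Prop :=
  Ordinal.omega0 ≤ μ ∧ μ.cof.ord = μ

/-- The ordinal `μ` is an uncountable regular cardinal. -/
def IsUncRegular (μ : Ordinal) : Prop :=
  Ordinal.omega0 < μ ∧ μ.cof.ord = μ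

/-- `κ` is weakly Mahlo: uncountable regular and the set of uncountable regular
cardinals below `κ` is stationary in `κ`. -/
def IsWeaklyMahlo (κ : Ordinal) : Prop :=
  IsUncRegular κ ∧ IsStationaryIn {μ | μ < κ ∧ IsUncRegular μ} κ

/-- `κ` is `α`-weakly Mahlo, by recursion on `α`: `κ` is `0`-weakly Mahlo iff it is
weakly Mahlo; for `α ≠ 0`, `κ` is `α`-weakly Mahlo iff for every `β < α` the set of
`β`-weakly Mahlo cardinals below `κ` is stationary in `κ`. -/
def IsAlphaWeaklyMahlo (κ : Ordinal) (α : Ordinal) : Prop :=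
  (α = 0 ∧ IsWeaklyMahlo κ) ∨
    (α ≠ 0 ∧ ∀ β : Ordinal, β < α →
      IsStationaryIn {μ | μ < κ ∧ IsAlphaWeaklyMahlo μ β} κ)
termination_by α

/-- `Reg(κ)`: the set of infinite regular cardinals below `κ`. -/
def RegSet (κ : Ordinal) : Set Ordinal := {μ | μ < κ ∧ IsInfRegular μ}

/-- The Mahlo operation. -/
def Ml (S : Set Ordinal) : Set Ordinal :=
  {α | α ∈ S ∧ Cardinal.aleph0 < α.cof ∧ IsStationaryIn (S ∩ Set.Iio α) α}

/-- Iterates of the Mahlo operation. -/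
noncomputable def MlIter (S : Set Ordinal) (α : Ordinal) : Set Ordinal :=
  Ordinal.limitRecOn α S (fun _ ih => Ml ih)
    (fun γ _ ih => ⋂ (β : Ordinal), ⋂ (h : β < γ), ih β h)

/-- Diagonal intersection of a `κ`-indexed family of subsets of `κ`. -/
def diagInter (κ : Ordinal) (S : Ordinal → Set Ordinal) : Set Ordinal :=
  {β | β < κ ∧ ∀ α < β, β ∈ S α}

/-- A (proper) filter on the ordinal `κ`, i.e. on the set of ordinals `< κ`. -/
structure OrdFilter (κ : Ordinal) where
  sets : Set (Set Ordinal)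
  mem_subset : ∀ S ∈ sets, S ⊆ Set.Iio κ
  univ_mem : Set.Iio κ ∈ sets
  superset_mem : ∀ S ∈ sets, ∀ T : Set Ordinal, S ⊆ T → T ⊆ Set.Iio κ → T ∈ sets
  inter_mem : ∀ S ∈ sets, ∀ T ∈ sets, S ∩ T ∈ sets
  proper : (∅ : Set Ordinal) ∉ sets

/-- `F` is uniform: every end-segment `κ ∖ α` belongs to `F`. -/
def OrdFilter.Uniform {κ : Ordinal} (F : OrdFilter κ) : Prop :=
  ∀ α < κ, (Set.Iio κ \ Set.Iio α) ∈ F.sets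

/-- `F` is non-principal: `κ ∖ {α}` belongs to `F` for every `α < κ`. -/
def OrdFilter.NonPrincipal {κ : Ordinal} (F : OrdFilter κ) : Prop :=
  ∀ α < κ, (Set.Iio κ \ {α}) ∈ F.sets

/-- `F` is `< κ`-complete: closed under intersections of fewer than `κ` of its members. -/
def OrdFilter.Complete {κ : Ordinal} (F : OrdFilter κ) : Prop :=
  ∀ δ < κ, ∀ S : Ordinal → Set Ordinal, (∀ ξ < δ, S ξ ∈ F.sets) →
    (Set.Iio κ ∩ ⋂ (ξ : Ordinal), ⋂ (_ : ξ < δ), S ξ) ∈ F.sets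

/-- `F` is normal: closed under diagonal intersections of `κ`-sequences of its members. -/
def OrdFilter.Normal {κ : Ordinal} (F : OrdFilter κ) : Prop :=
  ∀ S : Ordinal → Set Ordinal, (∀ α < κ, S α ∈ F.sets) → diagInter κ S ∈ F.sets

/-- `κ` is weakly inaccessible: an uncountable regular limit cardinal. -/
def IsWeaklyInaccessible (κ : Ordinal) : Prop :=
  IsUncRegular κ ∧ ∀ c : Cardinal, c < κ.card → Order.succ c < κ.card

/-- `F` witnesses the greatly weak Mahloness of `κ`: `F` is a proper uniform
`< κ`-complete normal filter on `κ` containing `Reg(κ)` and closed under the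
Mahlo operation. -/
def WitnessesGreatlyWeaklyMahlo (κ : Ordinal) (F : OrdFilter κ) : Prop :=
  F.Uniform ∧ F.Complete ∧ F.Normal ∧ RegSet κ ∈ F.sets ∧ ∀ S ∈ F.sets, Ml S ∈ F.sets

/-- `κ` is greatly weakly Mahlo. -/
def IsGreatlyWeaklyMahlo (κ : Ordinal) : Prop :=
  IsWeaklyInaccessible κ ∧ ∃ F : OrdFilter κ, WitnessesGreatlyWeaklyMahlo κ F

def ctblInf {α : Type*} (X : Set α) : Set (Set α) :=
  {x | x ⊆ X ∧ x.Countable ∧ x.Infinite}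

/-- `C ⊆ [X]^{ℵ₀}` is club: cofinal (every countable subset of `X` is contained in a
member of `C`) and closed under unions of `⊆`-increasing `ω`-sequences of members. -/
def IsClubOn {α : Type*} (X : Set α) (C : Set (Set α)) : Prop :=
  C ⊆ ctblInf X ∧
    (∀ x : Set α, x ⊆ X → x.Countable → ∃ y ∈ C, x ⊆ y) ∧
    ∀ f : ℕ → Set α, (∀ n, f n ∈ C) → (∀ m n : ℕ, m ≤ n → f m ⊆ f n) →
      (⋃ n, f n) ∈ C

/-- `S ⊆ [X]^{ℵ₀}` is stationary: it meets every club subset of `[X]^{ℵ₀}`. -/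
def IsStatOn {α : Type*} (X : Set α) (S : Set (Set α)) : Prop :=
  ∀ C : Set (Set α), IsClubOn X C → (S ∩ C).Nonempty

/-- A set of fewer than `cof δ` ordinals below `δ` has a strict upper bound below `δ`. -/
theorem exists_strict_bound_lt {δ : Ordinal.{0}} {s : Set Ordinal.{0}} (hs : ∀ a ∈ s, a < δ)
    (h : Cardinal.mk s < Cardinal.lift.{1} δ.cof) : ∃ γ < δ, ∀ a ∈ s, a < γ := by
  refine ⟨sSup ((· + 1) '' s), Ordinal.sSup_add_one_lt_of_lt_cof (by simpa using h) hs, ?_⟩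
  intro a ha
  refine (lt_add_one a).trans_le (le_csSup ⟨δ, ?_⟩ ⟨a, ha, rfl⟩)
  rintro _ ⟨b, hb, rfl⟩
  exact Order.add_one_le_of_lt (hs b hb)

theorem exists_strict_bound_lt_of_countable {δ : Ordinal.{0}} {s : Set Ordinal.{0}}
    (hs : ∀ a ∈ s, a < δ) (hc : s.Countable) (h : Cardinal.aleph0 < δ.cof) :
    ∃ γ < δ, ∀ a ∈ s, a < γ :=
  exists_strict_bound_lt hs
    (hc.le_aleph0.trans_lt (Cardinal.aleph0_lt_lift.2 h))

theorem exists_mem_forall_list_lt {α : Type*} [LinearOrder α] {B : Set α} (hB : B.Nonempty)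
    (l : List α) (h : ∀ a ∈ l, ∃ b ∈ B, a < b) : ∃ b ∈ B, ∀ a ∈ l, a < b := by
  induction l with
  | nil => exact hB.imp fun b hb => ⟨hb, by simp⟩
  | cons a l ih =>
    obtain ⟨b, hb, hl⟩ := ih fun c hc => h c (List.mem_cons_of_mem _ hc)
    obtain ⟨b', hb', ha⟩ := h a List.mem_cons_self
    rcases le_total b b' with hbb | hbb
    · refine ⟨b', hb', fun c hc => ?_⟩
      rcases List.mem_cons.1 hc with rfl | hc
      exacts [ha, (hl c hc).trans_le hbb]
    · refine ⟨b, hb, fun c hc => ?_⟩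
      rcases List.mem_cons.1 hc with rfl | hc
      exacts [ha.trans_le hbb, hl c hc]

/-- The closure points of a finitary operation on a regular uncountable cardinal form a club. -/
theorem isClubIn_closurePoints {μ : Ordinal.{0}} (hreg : μ.cof.ord = μ)
    (hμ : Cardinal.aleph0 < μ.cof) (h : List Ordinal.{0} → Ordinal.{0})
    (hh : ∀ l, (∀ a ∈ l, a < μ) → h l < μ) :
    IsClubIn {δ | δ < μ ∧ ∀ l, (∀ a ∈ l, a < δ) → h l < δ} μ := by
  refine ⟨fun δ hδ => hδ.1, fun α hα => ?_, fun B hB hne hlt => ⟨hlt, fun l hl => ?_⟩⟩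
  · have step : ∀ β < μ, ∃ γ < μ, β ≤ γ ∧ ∀ l, (∀ a ∈ l, a < β) → h l < γ := by
      intro β hβ
      let s : Set Ordinal := Set.range fun l : List (Set.Iio β) => h (l.map Subtype.val)
      have hs : ∀ a ∈ s, a < μ := by
        rintro _ ⟨l, rfl⟩
        refine hh _ fun a ha => ?_
        obtain ⟨b, -, rfl⟩ := List.mem_map.1 ha
        exact lt_trans b.2 hβ
      have hcard : Cardinal.mk s < Cardinal.lift.{1} μ.cof := by
        refine Cardinal.mk_range_le.trans_lt ((Cardinal.mk_list_le_max _).trans_lt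
          (max_lt (Cardinal.aleph0_lt_lift.2 hμ) ?_))
        rw [Cardinal.mk_Iio_ordinal, Cardinal.lift_lt]
        exact Cardinal.lt_ord.1 (hreg.symm ▸ hβ)
      obtain ⟨γ, hγ, hγs⟩ := exists_strict_bound_lt hs hcard
      refine ⟨max β γ, max_lt hβ hγ, le_max_left _ _, fun l hl => ?_⟩
      refine lt_of_lt_of_le (hγs _ ⟨l.attach.map fun a => ⟨a.1, hl a.1 a.2⟩, ?_⟩)
        (le_max_right _ _)
      simp
    choose! F hFμ hle hF using step
    let u : ℕ → Ordinal := fun n => F^[n] α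
    have hu : ∀ n, u (n + 1) = F (u n) := fun n => Function.iterate_succ_apply' F n α
    have huμ : ∀ n, u n < μ := fun n => by
      induction n with
      | zero => exact hα
      | succ n ih => rw [hu]; exact hFμ _ ih
    obtain ⟨γ, hγ, hγu⟩ := exists_strict_bound_lt_of_countable (s := Set.range u)
      (by rintro _ ⟨n, rfl⟩; exact huμ n) (Set.countable_range u) hμ
    have hbdd : BddAbove (Set.range u) := ⟨γ, fun a ha => (hγu a ha).le⟩
    refine ⟨⨆ n, u n, ⟨(ciSup_le fun n => (hγu _ ⟨n, rfl⟩).le).trans_lt hγ, fun l hl => ?_⟩,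
      le_ciSup hbdd 0⟩
    obtain ⟨_, ⟨n, rfl⟩, hn⟩ := exists_mem_forall_list_lt (Set.range_nonempty u) l fun a ha => by
      obtain ⟨n, hn⟩ := (lt_ciSup_iff hbdd).1 (hl a ha)
      exact ⟨_, ⟨n, rfl⟩, hn⟩
    refine (hF (u n) (huμ n) l hn).trans_le ?_
    rw [← hu]
    exact le_ciSup hbdd (n + 1)
  · have hbdd : BddAbove B := ⟨μ, fun b hb => (hB hb).1.le⟩
    obtain ⟨b, hb, hlb⟩ := exists_mem_forall_list_lt hne l fun a ha =>
      (lt_csSup_iff hbdd hne).1 (hl a ha)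
    exact ((hB hb).2 l hlb).trans_le (le_csSup hbdd hb)

/-- A club contains each of its limit points. -/
theorem IsClubIn.mem_of_forall_exists {C : Set Ordinal.{0}} {μ δ : Ordinal.{0}}
    (hC : IsClubIn C μ) (hδ : δ < μ) (hlim : Order.IsSuccLimit δ)
    (h : ∀ α < δ, ∃ β ∈ C, α ≤ β ∧ β < δ) : δ ∈ C := by
  obtain ⟨β₀, hβ₀, -, hlt₀⟩ := h 0 hlim.bot_lt
  have hbdd : BddAbove (C ∩ Set.Iio δ) := ⟨δ, fun b hb => hb.2.le⟩
  have hsup : sSup (C ∩ Set.Iio δ) = δ := by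
    refine le_antisymm (csSup_le ⟨β₀, hβ₀, hlt₀⟩ fun b hb => hb.2.le) (le_of_not_gt fun hlt => ?_)
    obtain ⟨β, hβ, hle, hβδ⟩ := h _ (hlim.succ_lt hlt)
    exact (Order.succ_le_iff.1 hle).not_ge (le_csSup hbdd ⟨hβ, hβδ⟩)
  have := hC.2.2 (C ∩ Set.Iio δ) Set.inter_subset_left ⟨β₀, hβ₀, hlt₀⟩ (hsup.symm ▸ hδ)
  rwa [hsup] at this

theorem IsStationaryIn.mono {S T : Set Ordinal.{0}} {μ : Ordinal.{0}} (hS : IsStationaryIn S μ)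
    (h : S ⊆ T) : IsStationaryIn T μ :=
  fun C hC => (hS C hC).mono (Set.inter_subset_inter_left C h)

/-- Normality of the nonstationary ideal on a regular uncountable cardinal. -/
theorem IsStationaryIn.exists_forall_notMem {μ : Ordinal.{0}} (hreg : μ.cof.ord = μ)
    (hμ : Cardinal.aleph0 < μ.cof) {E : Set Ordinal.{0}} (hE : IsStationaryIn E μ)
    (T : Ordinal.{0} → Set Ordinal.{0}) (hT : ∀ η < μ, ¬ IsStationaryIn (T η) μ)
    {γ : Ordinal.{0}} (hγ : γ < μ) : ∃ δ ∈ E, γ < δ ∧ δ < μ ∧ ∀ η < δ, δ ∉ T η := by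
  have hlimμ : Order.IsSuccLimit μ := Ordinal.one_lt_cof_iff.1 (Cardinal.one_lt_aleph0.trans hμ)
  have : ∀ η < μ, ∃ D, IsClubIn D μ ∧ T η ∩ D = ∅ := fun η hη => by
    have := hT η hη
    simp only [IsStationaryIn, not_forall, Set.not_nonempty_iff_eq_empty] at this
    obtain ⟨D, hD, h⟩ := this
    exact ⟨D, hD, h⟩
  choose! D hD hTD using this
  have : ∀ η < μ, ∀ α < μ, ∃ β ∈ D η, α ≤ β := fun η hη => (hD η hη).2.1
  choose! nx hnx hle using this
  let h : List Ordinal → Ordinal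
    | [η, α] => nx η α
    | [α] => Order.succ α
    | _ => γ
  obtain ⟨δ, hδE, hδμ, hδ⟩ := hE _ <| isClubIn_closurePoints hreg hμ h fun l hl => by
    match l with
    | [] => exact hγ
    | [α] => exact hlimμ.succ_lt (hl α (by simp))
    | [η, α] => exact (hD η (hl η (by simp))).1 (hnx η (hl η (by simp)) α (hl α (by simp)))
    | _ :: _ :: _ :: _ => exact hγ
  have hγδ : γ < δ := hδ [] (by simp)
  have hlim : Order.IsSuccLimit δ :=
    ⟨not_isMin_of_lt hγδ,
      Order.isSuccPrelimit_of_succ_lt fun α hα => hδ [α] (by simpa using hα)⟩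
  refine ⟨δ, hδE, hγδ, hδμ, fun η hη hmem => ?_⟩
  have hημ := hη.trans hδμ
  have : δ ∈ D η := (hD η hημ).mem_of_forall_exists hδμ hlim fun α hα =>
    ⟨nx η α, hnx η hημ α (hα.trans hδμ), hle η hημ α (hα.trans hδμ),
      hδ [η, α] (by simp [hη, hα])⟩
  exact (Set.eq_empty_iff_forall_notMem.1 (hTD η hημ)) δ ⟨hmem, this⟩

/-- An ordinal of countable nonzero cofinality is the limit of an `ω`-sequence. -/
theorem exists_seq_cofinal {δ : Ordinal.{0}} (h0 : δ ≠ 0) (h : δ.cof ≤ Cardinal.aleph0) :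
    ∃ c : ℕ → Ordinal.{0}, (∀ n, c n < δ) ∧ ∀ α < δ, ∃ n, α ≤ c n := by
  obtain ⟨s, hs, hcard⟩ := Order.exists_cof_eq (Set.Iio δ)
  have hcount : s.Countable := by
    rw [← Cardinal.le_aleph0_iff_set_countable, hcard, Ordinal.cof_Iio, ← Ordinal.lift_cof]
    exact Cardinal.lift_le_aleph0.2 h
  obtain ⟨b, hb, -⟩ := hs ⟨0, pos_iff_ne_zero.2 h0⟩
  obtain ⟨f, rfl⟩ := hcount.exists_eq_range ⟨b, hb⟩
  refine ⟨fun n => f n, fun n => (f n).2, fun α hα => ?_⟩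
  obtain ⟨_, ⟨n, rfl⟩, hn⟩ := hs ⟨α, hα⟩
  exact ⟨n, hn⟩

theorem not_isStationaryIn_empty {μ : Ordinal.{0}} : ¬ IsStationaryIn ∅ μ := fun h => by
  obtain ⟨_, h, -⟩ := h (Set.Iio μ)
    ⟨subset_rfl, fun α hα => ⟨α, hα, le_rfl⟩, fun _ _ _ h => h⟩
  exact h

/-- A stationary set of ordinals of countable cofinality splits into `ω₁` stationary pieces. -/
theorem IsStationaryIn.exists_splitting {μ : Ordinal.{0}} (hreg : μ.cof.ord = μ)
    (hμ : Cardinal.aleph 1 < μ.cof) {E : Set Ordinal.{0}} (hE : IsStationaryIn E μ)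
    (hEcof : ∀ δ ∈ E, δ.cof = Cardinal.aleph0) :
    ∃ g : Ordinal.{0} → Ordinal.{0}, (∀ δ, g δ < (Cardinal.aleph 1).ord) ∧
      ∀ i < (Cardinal.aleph 1).ord, IsStationaryIn {δ ∈ E | g δ = i} μ := by
  have hμ0 : Cardinal.aleph0 < μ.cof := Cardinal.aleph0_lt_aleph_one.trans hμ
  have hωμ : Ordinal.omega0 < μ := by
    rw [← hreg, ← Cardinal.ord_aleph0]
    exact Cardinal.ord_lt_ord.2 hμ0
  have hseq : ∀ δ ∈ E, ∃ c : ℕ → Ordinal.{0}, (∀ n, c n < δ) ∧ ∀ α < δ, ∃ n, α ≤ c n :=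
    fun δ hδ => exists_seq_cofinal
      (fun h => by simpa [h, eq_comm, Cardinal.aleph0_ne_zero] using hEcof δ hδ) (hEcof δ hδ).le
  choose! c hcδ hc using hseq
  obtain ⟨n, hn⟩ : ∃ n, ∀ γ < μ, IsStationaryIn {δ ∈ E | γ ≤ c δ n} μ := by
    by_contra! hcon
    choose γ hγ hns using hcon
    obtain ⟨γ', hγ', hlt⟩ := exists_strict_bound_lt_of_countable (s := Set.range γ)
      (by rintro _ ⟨n, rfl⟩; exact hγ n) (Set.countable_range γ) hμ0
    obtain ⟨δ, hδE, hδ, hδμ, hnot⟩ := hE.exists_forall_notMem hreg hμ0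
      (fun η => {δ ∈ E | ∃ n : ℕ, (n : Ordinal) = η ∧ γ n ≤ c δ n})
      (fun η _ hst => by
        by_cases hη : ∃ n : ℕ, (n : Ordinal) = η
        · obtain ⟨n, rfl⟩ := hη
          refine hns n (hst.mono ?_)
          rintro δ ⟨hδ, m, hm, hle⟩
          obtain rfl : m = n := by exact_mod_cast hm
          exact ⟨hδ, hle⟩
        · refine not_isStationaryIn_empty (hst.mono ?_)
          rintro δ ⟨-, m, hm, -⟩
          exact hη ⟨m, hm⟩) (max_lt hγ' hωμ)
    obtain ⟨n, hn⟩ := hc δ hδE γ' ((le_max_left _ _).trans_lt hδ)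
    refine hnot n ((Ordinal.natCast_lt_omega0 n).trans ((le_max_right _ _).trans_lt hδ))
      ⟨hδE, n, rfl, (hlt _ ⟨n, rfl⟩).le.trans hn⟩
  have hfib : ∀ γ < μ, ∃ η < μ, γ ≤ η ∧ IsStationaryIn {δ ∈ E | c δ n = η} μ := by
    intro γ hγ
    by_contra! hcon
    obtain ⟨δ, ⟨hδE, hle⟩, -, hδμ, hnot⟩ := (hn γ hγ).exists_forall_notMem hreg hμ0
      (fun η => {δ ∈ E | c δ n = η ∧ γ ≤ η})
      (fun η hη hst => by
        by_cases h : γ ≤ η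
        · exact hcon η hη h (hst.mono fun δ hδ => ⟨hδ.1, hδ.2.1⟩)
        · exact not_isStationaryIn_empty (hst.mono fun δ hδ => h hδ.2.2)) hγ
    exact hnot _ (hcδ δ hδE n) ⟨hδE, rfl, hle⟩
  let A : Set Ordinal := {η | η < μ ∧ IsStationaryIn {δ ∈ E | c δ n = η} μ}
  have hA : Cardinal.mk (Set.Iio (Cardinal.aleph 1).ord) ≤ Cardinal.mk A := by
    by_contra! hlt
    obtain ⟨γ, hγ, hAγ⟩ := exists_strict_bound_lt (s := A) (fun η hη => hη.1)
      (hlt.trans (by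
        rw [Cardinal.mk_Iio_ordinal, Cardinal.card_ord]
        exact Cardinal.lift_lt.2 hμ))
    obtain ⟨η, hη, hle, hst⟩ := hfib γ hγ
    exact hle.not_gt (hAγ η ⟨hη, hst⟩)
  obtain ⟨e⟩ := hA
  have : Nonempty (Set.Iio (Cardinal.aleph.{0} 1).ord) :=
    ⟨0, (Cardinal.isRegular_aleph_one).ord_pos⟩
  refine ⟨fun δ => (Function.invFun (fun i => (e i : Ordinal)) (c δ n)).1,
    fun δ => (Function.invFun (fun i => (e i : Ordinal)) (c δ n)).2, fun i hi => ?_⟩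
  refine (e ⟨i, hi⟩).2.2.mono fun δ hδ => ⟨hδ.1, ?_⟩
  simp only [hδ.2]
  exact congrArg Subtype.val
    (Function.leftInverse_invFun (Subtype.val_injective.comp e.injective) ⟨i, hi⟩)

/-- `y` is lost with rank at most `ξ` in the game where the first player plays labels `α`, the
second player answers by moves along `R α`, and the first player tries to block the second. -/
inductive LostWithRank {Y : Type 1} {I : Type*} (R : I → Y → Y → Prop) :
    Ordinal.{1} → Y → Prop
  | intro (ξ : Ordinal.{1}) (y : Y) (α : I) (r : Y → Ordinal.{1})
      (hr : ∀ y', R α y y' → r y' < ξ) (h : ∀ y', R α y y' → LostWithRank R (r y') y') :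
      LostWithRank R ξ y

/-- Determinacy of such a game: either the second player can move forever from some position, or
the first player has a positional strategy along which a rank decreases. -/
theorem exists_invariant_or_exists_rank {Y : Type 1} {I : Type*} (R : I → Y → Y → Prop) :
    (∃ P : Set Y, P.Nonempty ∧ ∀ y ∈ P, ∀ α, ∃ y' ∈ P, R α y y') ∨
      ∃ (rank : Y → Ordinal.{1}) (a : Y → I), ∀ y y', R (a y) y y' → rank y' < rank y := by
  by_cases hP : ∃ y, ∀ ξ, ¬ LostWithRank R ξ y
  · refine .inl ⟨{y | ∀ ξ, ¬ LostWithRank R ξ y}, hP, fun y hy α => ?_⟩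
    by_contra! hcon
    have : ∀ y', R α y y' → ∃ ξ, LostWithRank R ξ y' := fun y' hR => by
      by_contra! h
      exact hcon y' h hR
    choose! r hr using this
    exact hy (⨆ y', Order.succ (r y')) (.intro _ y α r
      (fun y' _ => (Order.lt_succ _).trans_le (Ordinal.le_iSup (fun y' => Order.succ (r y')) y'))
      hr)
  · push Not at hP
    have hmin : ∀ y, ∃ ξ, LostWithRank R ξ y ∧ ∀ ζ, LostWithRank R ζ y → ξ ≤ ζ := fun y =>
      ⟨sInf {ξ | LostWithRank R ξ y}, csInf_mem (hP y), fun ζ hζ => csInf_le' hζ⟩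
    choose rank hrank hle using hmin
    have : ∀ y, ∃ α, ∀ y', R α y y' → rank y' < rank y := fun y => by
      cases hrank y with
      | intro _ _ α r hr h => exact ⟨α, fun y' hR => (hle y' _ (h y' hR)).trans_lt (hr y' hR)⟩
    choose a ha using this
    exact .inr ⟨rank, a, ha⟩

/-- Inside a club of `[μ]^{ℵ₀}` one can keep increasing the supremum without ever leaving some
fixed countable bound for the trace on `ω₁`. -/
theorem IsClubOn.exists_bounded_trace {μ : Ordinal.{0}} (hμ : Cardinal.aleph 1 < μ.cof)
    {C : Set (Set Ordinal.{0})} (hC : IsClubOn (Set.Iio μ) C) :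
    ∃ i < (Cardinal.aleph 1).ord, ∃ P ⊆ C, P.Nonempty ∧
      (∀ y ∈ P, ∀ a ∈ y, a < (Cardinal.aleph 1).ord → a < i) ∧
      ∀ y ∈ P, ∀ α < μ, ∃ y' ∈ P, y ⊆ y' ∧ ∃ β ∈ y', α ≤ β := by
  have hpos : 0 < μ := Ordinal.cof_pos.1 ((Cardinal.aleph_pos 1).trans hμ)
  let D : Ordinal → Set (Set Ordinal) := fun i =>
    {y | y ∈ C ∧ ∀ a ∈ y, a < (Cardinal.aleph 1).ord → a < i}
  let R : Ordinal → Set.Iio μ → Set Ordinal → Set Ordinal → Prop := fun i α y y' =>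
    y' ∈ D i ∧ y ⊆ y' ∧ ∃ β ∈ y', α.1 ≤ β
  by_cases hP : ∃ i < (Cardinal.aleph 1).ord, ∃ P : Set (Set Ordinal), P.Nonempty ∧
      ∀ y ∈ P, ∀ α, ∃ y' ∈ P, R i α y y'
  · obtain ⟨i, hi, P, ⟨y, hy⟩, hP⟩ := hP
    obtain ⟨y₀, hy₀, hR₀⟩ := hP y hy ⟨0, hpos⟩
    refine ⟨i, hi, P ∩ D i, fun y hy => hy.2.1, ⟨y₀, hy₀, hR₀.1⟩, fun y hy => hy.2.2,
      fun y hy α hα => ?_⟩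
    obtain ⟨y', hy', hR⟩ := hP y hy.1 ⟨α, hα⟩
    exact ⟨y', ⟨hy', hR.1⟩, hR.2⟩
  exfalso
  have hrank : ∀ i < (Cardinal.aleph 1).ord, ∃ (rank : Set Ordinal → Ordinal.{1})
      (a : Set Ordinal → Set.Iio μ), ∀ y y', R i (a y) y y' → rank y' < rank y := fun i hi =>
    (exists_invariant_or_exists_rank (R i)).resolve_left fun h => hP ⟨i, hi, h⟩
  have : Nonempty (Set.Iio μ) := ⟨0, hpos⟩
  choose! rank a ha using hrank
  have hnext : ∀ y ∈ C, ∃ y' ∈ C, y ⊆ y' ∧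
      ∀ i < (Cardinal.aleph 1).ord, ∃ β ∈ y', (a i y).1 ≤ β := by
    intro y hy
    obtain ⟨γ, hγ, hlt⟩ := exists_strict_bound_lt (δ := μ)
      (s := (fun i => (a i y).1) '' Set.Iio (Cardinal.aleph 1).ord)
      (by rintro _ ⟨i, -, rfl⟩; exact (a i y).2)
      (Cardinal.mk_image_le.trans_lt (by
        rw [Cardinal.mk_Iio_ordinal, Cardinal.card_ord]
        exact Cardinal.lift_lt.2 hμ))
    obtain ⟨y', hy', hsub⟩ := hC.2.1 (insert γ y)
      (Set.insert_subset hγ (hC.1 hy).1) ((hC.1 hy).2.1.insert γ)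
    exact ⟨y', hy', (Set.subset_insert _ _).trans hsub, fun i hi =>
      ⟨γ, hsub (Set.mem_insert _ _), (hlt _ ⟨i, hi, rfl⟩).le⟩⟩
  choose! nx hnxC hsub hnx using hnext
  obtain ⟨y₀, hy₀, -⟩ := hC.2.1 ∅ (Set.empty_subset _) Set.countable_empty
  let u : ℕ → Set Ordinal := fun n => nx^[n] y₀
  have hu : ∀ n, u (n + 1) = nx (u n) := fun n => Function.iterate_succ_apply' nx n y₀
  have huC : ∀ n, u n ∈ C := fun n => by
    induction n with
    | zero => exact hy₀
    | succ n ih => rw [hu]; exact hnxC _ ih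
  obtain ⟨i, hi, hlt⟩ := exists_strict_bound_lt_of_countable (δ := (Cardinal.aleph 1).ord)
    (s := (⋃ n, u n) ∩ Set.Iio (Cardinal.aleph 1).ord) (fun a ha => ha.2)
    ((Set.countable_iUnion fun n => (hC.1 (huC n)).2.1).mono Set.inter_subset_left)
    (by rw [Cardinal.isRegular_aleph_one.cof_ord]; exact Cardinal.aleph0_lt_aleph_one)
  have hdec : ∀ n, rank i (u (n + 1)) < rank i (u n) := fun n => by
    refine ha i hi _ _ ⟨⟨huC _, fun b hb hb' => hlt b ⟨Set.mem_iUnion.2 ⟨_, hb⟩, hb'⟩⟩, ?_⟩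
    rw [hu]
    exact ⟨hsub _ (huC n), hnx _ (huC n) i hi⟩
  obtain ⟨n, hn⟩ := WellFounded.not_rel_apply_succ (r := (· < ·)) fun n => rank i (u n)
  exact hn (hdec n)

/-- The countable infinite subsets of `X` containing `d` and closed under `p` form a club. -/
theorem isClubOn_closed {X : Set Ordinal.{0}} {d : Set Ordinal.{0}} (hd : d ⊆ X)
    (hdc : d.Countable) (hdi : d.Infinite) {p : Ordinal.{0} → Ordinal.{0}}
    (hp : ∀ α ∈ X, p α ∈ X) :
    IsClubOn X {x ∈ ctblInf X | d ⊆ x ∧ ∀ α ∈ x, p α ∈ x} := by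
  refine ⟨fun x hx => hx.1, fun x hx hxc => ?_, fun f hf _ => ?_⟩
  · refine ⟨⋃ n : ℕ, p^[n] '' (x ∪ d), ⟨⟨?_, ?_, ?_⟩, ?_, ?_⟩, ?_⟩
    · refine Set.iUnion_subset fun n => ?_
      rintro _ ⟨α, hα, rfl⟩
      have hα : α ∈ X := Set.union_subset hx hd hα
      induction n with
      | zero => exact hα
      | succ n ih => rw [Function.iterate_succ_apply']; exact hp _ ih
    · exact Set.countable_iUnion fun n => (hxc.union hdc).image _
    · exact hdi.mono fun a ha => Set.mem_iUnion.2 ⟨0, a, .inr ha, rfl⟩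
    · exact fun a ha => Set.mem_iUnion.2 ⟨0, a, .inr ha, rfl⟩
    · intro α hα
      obtain ⟨n, a, ha, rfl⟩ := Set.mem_iUnion.1 hα
      exact Set.mem_iUnion.2 ⟨n + 1, a, ha, Function.iterate_succ_apply' p n a⟩
    · exact fun a ha => Set.mem_iUnion.2 ⟨0, a, .inl ha, rfl⟩
  · refine ⟨⟨Set.iUnion_subset fun n => (hf n).1.1,
      Set.countable_iUnion fun n => (hf n).1.2.1,
      (hf 0).1.2.2.mono (Set.subset_iUnion f 0)⟩,
      (hf 0).2.1.trans (Set.subset_iUnion f 0), fun α hα => ?_⟩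
    obtain ⟨n, hn⟩ := Set.mem_iUnion.1 hα
    exact Set.mem_iUnion.2 ⟨n, (hf n).2.2 α hn⟩

/-- The countable infinite `x` whose supremum `δ` is a limit in `E` and whose trace on `ω₁` is
bounded by `g δ`. -/
def traceBoundedSets (μ : Ordinal.{0}) (E : Set Ordinal.{0}) (g : Ordinal.{0} → Ordinal.{0}) :
    Set (Set Ordinal.{0}) :=
  {x ∈ ctblInf (Set.Iio μ) | ∃ δ ∈ E, (∀ a ∈ x, a < δ) ∧ (∀ α < δ, ∃ β ∈ x, α ≤ β) ∧
    ∀ a ∈ x, a < (Cardinal.aleph 1).ord → a < g δ}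

theorem isStatOn_traceBoundedSets {μ : Ordinal.{0}} (hreg : μ.cof.ord = μ)
    (hμ : Cardinal.aleph 1 < μ.cof) {E : Set Ordinal.{0}}
    (hEcof : ∀ δ ∈ E, δ.cof = Cardinal.aleph0) {g : Ordinal.{0} → Ordinal.{0}}
    (hg : ∀ i < (Cardinal.aleph 1).ord, IsStationaryIn {δ ∈ E | g δ = i} μ) :
    IsStatOn (Set.Iio μ) (traceBoundedSets μ E g) := by
  intro C hC
  have hμ0 : Cardinal.aleph0 < μ.cof := Cardinal.aleph0_lt_aleph_one.trans hμ
  obtain ⟨i, hi, P, hPC, ⟨y₀, hy₀⟩, hPi, hP⟩ := hC.exists_bounded_trace hμ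
  choose! τ hτP hτsub hτ using hP
  let F : List Ordinal → Set Ordinal := fun l => l.foldr (fun α y => τ y α) y₀
  have hFP : ∀ l, (∀ a ∈ l, a < μ) → F l ∈ P := fun l hl => by
    induction l with
    | nil => exact hy₀
    | cons α l ih =>
      exact hτP _ (ih fun a ha => hl a (List.mem_cons_of_mem _ ha)) α (hl α List.mem_cons_self)
  have hbd : ∀ l, (∀ a ∈ l, a < μ) → ∃ γ < μ, ∀ a ∈ F l, a < γ := fun l hl =>
    have h := hC.1 (hPC (hFP l hl))
    exists_strict_bound_lt_of_countable h.1 h.2.1 hμ0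
  choose! h hhμ hh using hbd
  obtain ⟨δ, ⟨hδE, hgδ⟩, hδμ, hδ⟩ := hg i hi _ (isClubIn_closurePoints hreg hμ0 h hhμ)
  obtain ⟨c, hcδ, hc⟩ := exists_seq_cofinal
    (fun h => by simpa [h, eq_comm, Cardinal.aleph0_ne_zero] using hEcof δ hδE) (hEcof δ hδE).le
  let L : ℕ → List Ordinal := fun n => n.rec [] fun n l => c n :: l
  have hL : ∀ n, ∀ a ∈ L n, a < δ := fun n => by
    induction n with
    | zero => simp [L]
    | succ n ih =>
      intro a ha
      rcases List.mem_cons.1 ha with rfl | ha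
      exacts [hcδ n, ih a ha]
  have hLμ : ∀ n, ∀ a ∈ L n, a < μ := fun n a ha => (hL n a ha).trans hδμ
  have hFL : ∀ n, F (L n) ∈ P := fun n => hFP _ (hLμ n)
  have hmem : (⋃ n, F (L n)) ∈ C := hC.2.2 _ (fun n => hPC (hFL n)) fun m n hmn =>
    monotone_nat_of_le_succ (f := fun n => F (L n))
      (fun n => hτsub _ (hFL n) _ ((hcδ n).trans hδμ)) hmn
  refine ⟨_, ⟨hC.1 hmem, δ, hδE, fun a ha => ?_, fun α hα => ?_, fun a ha ha1 => ?_⟩, hmem⟩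
  · obtain ⟨n, hn⟩ := Set.mem_iUnion.1 ha
    exact (hh _ (hLμ n) a hn).trans (hδ _ (hL n))
  · obtain ⟨n, hn⟩ := hc α hα
    obtain ⟨β, hβ, hle⟩ := hτ _ (hFL n) _ ((hcδ n).trans hδμ)
    exact ⟨β, Set.mem_iUnion.2 ⟨n + 1, hβ⟩, hn.trans hle⟩
  · obtain ⟨n, hn⟩ := Set.mem_iUnion.1 ha
    exact hgδ ▸ hPi _ (hFL n) a hn ha1

theorem not_isStatOn_traceBoundedSets {μ : Ordinal.{0}} {E : Set Ordinal.{0}}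
    (hEcof : ∀ δ ∈ E, δ.cof = Cardinal.aleph0)
    (hnonrefl : ∀ α < μ, Cardinal.aleph0 < α.cof → ¬ IsStationaryIn (E ∩ Set.Iio α) α)
    {g : Ordinal.{0} → Ordinal.{0}} (hg : ∀ δ, g δ < (Cardinal.aleph 1).ord)
    {X : Set Ordinal.{0}} {γ : Ordinal.{0}} (hγ : γ < μ) (hXγ : ∀ a ∈ X, a < γ)
    (hX : Set.Iio (Cardinal.aleph 1).ord ⊆ X) :
    ¬ IsStatOn X (traceBoundedSets μ E g ∩ ctblInf X) := by
  intro hst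
  obtain ⟨δ, hXδ, hδmin⟩ : ∃ δ : Ordinal, (∀ a ∈ X, a < δ) ∧ ∀ ε, (∀ a ∈ X, a < ε) → δ ≤ ε :=
    ⟨sInf {δ | ∀ a ∈ X, a < δ}, csInf_mem (s := {δ | ∀ a ∈ X, a < δ}) ⟨γ, hXγ⟩,
      fun ε hε => csInf_le' hε⟩
  have hcof : ∀ α < δ, ∃ β ∈ X, α ≤ β := fun α hα => by
    by_contra! h
    exact (hδmin α h).not_gt hα
  have hω : Set.range (fun n : ℕ => (n : Ordinal.{0})) ⊆ Set.Iio (Cardinal.aleph 1).ord := by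
    rintro _ ⟨n, rfl⟩
    refine (Ordinal.natCast_lt_omega0 n).trans ?_
    rw [← Cardinal.ord_aleph0]
    exact Cardinal.ord_lt_ord.2 Cardinal.aleph0_lt_aleph_one
  have hωi : (Set.range (fun n : ℕ => (n : Ordinal.{0}))).Infinite :=
    Set.infinite_range_of_injective Nat.cast_injective
  have hωc : (Set.range (fun n : ℕ => (n : Ordinal.{0}))).Countable := Set.countable_range _
  rcases le_or_gt δ.cof Cardinal.aleph0 with hδ | hδ
  · have h0 : δ ≠ 0 := (pos_of_gt (hXδ _ (hX (hω ⟨0, rfl⟩)))).ne'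
    obtain ⟨c, hcδ, hc⟩ := exists_seq_cofinal h0 hδ
    choose! e heX he using hcof
    obtain ⟨x, ⟨⟨-, δ', hδ'E, hxδ', hδ'x, htr⟩, -⟩, hxX, hdx, -⟩ := hst _ <|
      isClubOn_closed (X := X) (p := id)
        (d := insert (g δ) (Set.range (fun n : ℕ => (n : Ordinal)) ∪ Set.range fun n => e (c n)))
        (Set.insert_subset (hX (hg δ)) (Set.union_subset (hω.trans hX)
          (by rintro _ ⟨n, rfl⟩; exact heX _ (hcδ n))))
        ((hωc.union (Set.countable_range _)).insert _)
        (hωi.mono fun a ha => .inr (.inl ha)) (fun _ h => h)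
    obtain rfl : δ = δ' := by
      refine le_antisymm (le_of_not_gt fun hlt => ?_) (le_of_not_gt fun hlt => ?_)
      · obtain ⟨n, hn⟩ := hc δ' hlt
        exact ((hn.trans (he _ (hcδ n))).trans_lt
          (hxδ' _ (hdx (.inr (.inr ⟨n, rfl⟩))))).false
      · obtain ⟨β, hβ, hle⟩ := hδ'x δ hlt
        exact hle.not_gt (hXδ β (hxX.1 hβ))
    exact (htr _ (hdx (.inl rfl)) (hg δ)).false
  · have := hnonrefl δ ((hδmin γ hXγ).trans_lt hγ) hδ
    simp only [IsStationaryIn, not_forall, Set.not_nonempty_iff_eq_empty] at this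
    obtain ⟨D, hD, hED⟩ := this
    have hp : ∀ α ∈ X, ∃ β ∈ X, ∃ ζ ∈ D, α ≤ ζ ∧ ζ ≤ β := fun α hα => by
      obtain ⟨ζ, hζ, hle⟩ := hD.2.1 α (hXδ α hα)
      obtain ⟨β, hβ, hle'⟩ := hcof ζ (hD.1 hζ)
      exact ⟨β, hβ, ζ, hζ, hle, hle'⟩
    choose! p hpX hpD using hp
    obtain ⟨x, ⟨⟨-, δ', hδ'E, hxδ', hδ'x, -⟩, -⟩, hxX, -, hpx⟩ := hst _ <|
      isClubOn_closed (hω.trans hX) hωc hωi hpX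
    have hδ'lim : Order.IsSuccLimit δ' := Ordinal.one_lt_cof_iff.1
      (hEcof δ' hδ'E ▸ Cardinal.one_lt_aleph0)
    have hlt : δ' < δ := by
      refine lt_of_le_of_ne (le_of_not_gt fun hlt => ?_) ?_
      · obtain ⟨β, hβ, hle⟩ := hδ'x δ hlt
        exact hle.not_gt (hXδ β (hxX.1 hβ))
      · rintro rfl
        exact hδ.ne' (hEcof δ' hδ'E)
    have hmem : δ' ∈ D := hD.mem_of_forall_exists hlt hδ'lim fun α hα => by
      obtain ⟨β, hβ, hle⟩ := hδ'x α hα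
      obtain ⟨ζ, hζ, h1, h2⟩ := hpD β (hxX.1 hβ)
      exact ⟨ζ, hζ, hle.trans h1, h2.trans_lt (hxδ' _ (hpx β hβ))⟩
    exact (Set.eq_empty_iff_forall_notMem.1 hED) δ' ⟨⟨hδ'E, hlt⟩, hmem⟩

/-- If `μ` is a regular cardinal `> ℵ₁` carrying a non-reflecting stationary subset of
`E^μ_ω`, then there is a stationary `S ⊆ [μ]^{ℵ₀}` such that `S ∩ [X]^{ℵ₀}` is
non-stationary for every `X ⊆ μ` with `|X| < μ` and `ω₁ ⊆ X`. -/
theorem statement13 (μ : Ordinal.{0}) (hreg : IsInfRegular μ)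
    (hμ : (Cardinal.aleph 1).ord < μ)
    (E : Set Ordinal) (hE : E ⊆ {α | α < μ ∧ α.cof = Cardinal.aleph0})
    (hstat : IsStationaryIn E μ)
    (hnonrefl : ∀ α < μ, Cardinal.aleph0 < α.cof →
      ¬ IsStationaryIn (E ∩ Set.Iio α) α) :
    ∃ S : Set (Set Ordinal), S ⊆ ctblInf (Set.Iio μ) ∧ IsStatOn (Set.Iio μ) S ∧
      ∀ X : Set Ordinal, X ⊆ Set.Iio μ →
        Cardinal.mk X < Cardinal.lift.{1,0} μ.card →
        Set.Iio (Cardinal.aleph 1).ord ⊆ X →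
        ¬ IsStatOn X (S ∩ ctblInf X) := by
  have hcof : μ.cof = μ.card := by rw [← hreg.2, Cardinal.card_ord, hreg.2]
  have hμcof : Cardinal.aleph 1 < μ.cof := by
    rw [← Cardinal.ord_lt_ord, hreg.2]
    exact hμ
  have hEcof : ∀ δ ∈ E, δ.cof = Cardinal.aleph0 := fun δ hδ => (hE hδ).2
  obtain ⟨g, hg, hgst⟩ := hstat.exists_splitting hreg.2 hμcof hEcof
  refine ⟨traceBoundedSets μ E g, fun x hx => hx.1,
    isStatOn_traceBoundedSets hreg.2 hμcof hEcof hgst, fun X hXμ hcard hω => ?_⟩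
  obtain ⟨γ, hγ, hXγ⟩ := exists_strict_bound_lt hXμ (hcof ▸ hcard)
  exact not_isStatOn_traceBoundedSets hEcof hnonrefl hg hγ hXγ hω
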